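/- arXiv:2407.07568 — 3 statements merged into one kernel-verified Lean document; each statement's English description precedes it below -/
import Mathlib

section
/- Let 𝐝 = (d_1,…,d_s) with 1 ≤ d_1 < … < d_s < n, and let 𝐦, 𝐦' ∈ ℤ_{≥0}^{n−1} satisfy m_i = 0 and m'_i = 0 unless i ∈ {d_1,…,d_s}. Then for any M, M' ∈ ℤ_{≥0} the Minkowski sum of polytopes satisfies X_{𝐝,𝐦,M} + X_{𝐝,𝐦',M'} = X_{𝐝,𝐦+𝐦',M+M'}. -/
open scoped Pointwise

/-- The poset `P` of pairs `(i,j)` with `1 ≤ j < i ≤ n` (componentwise order). -/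
def posetP (n : ℕ) : Finset (ℕ × ℕ) :=
  (Finset.range (n + 1) ×ˢ Finset.range (n + 1)).filter
    (fun p => 1 ≤ p.2 ∧ p.2 < p.1 ∧ p.1 ≤ n)

/-- The subposet `P_d = {(i,j) ∈ P : i > d ≥ j}`. -/
def posetPd (n d : ℕ) : Finset (ℕ × ℕ) :=
  (posetP n).filter (fun p => d < p.1 ∧ p.2 ≤ d)

/-- `P_𝐝 = P_{d_1} ∪ … ∪ P_{d_s}` for `𝐝` given as a finite set `D ⊆ {1,…,n-1}`. -/
def posetPD (n : ℕ) (D : Finset ℕ) : Finset (ℕ × ℕ) :=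
  D.biUnion (posetPd n)

/-- The width of a finite subset of `ℕ × ℕ` (with the componentwise order):
the maximal cardinality of an antichain contained in it. -/
noncomputable def finWidth (Q : Finset (ℕ × ℕ)) : ℕ :=
  sSup (Finset.card '' {A : Finset (ℕ × ℕ) |
    A ⊆ Q ∧ IsAntichain (· ≤ ·) (A : Set (ℕ × ℕ))})

/-- The polytope `X_{𝐝,𝐦,M} ⊆ ℝ_{≥0}^{P_𝐝}`, realized as the set of functions
`ℕ × ℕ → ℝ` supported on `P_𝐝`, with nonnegative coordinates, satisfying for every
`P' ⊆ P_𝐝` the inequality `Σ_{α ∈ P'} x_α ≤ M + Σ_{a=1}^{s} m_{d_a} · w(P' ∩ P_{d_a})`. -/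
def polytopeXD (n : ℕ) (D : Finset ℕ) (m : ℕ → ℕ) (M : ℕ) : Set (ℕ × ℕ → ℝ) :=
  {x | (∀ α, α ∉ posetPD n D → x α = 0) ∧ (∀ α, 0 ≤ x α) ∧
    ∀ P' ⊆ posetPD n D,
      ∑ α ∈ P', x α ≤
        (M : ℝ) + ∑ d ∈ D, (m d : ℝ) * (finWidth (P' ∩ posetPd n d) : ℝ)}

lemma finWidth_le {Q : Finset (ℕ × ℕ)} {k : ℕ}
    (h : ∀ A ⊆ Q, IsAntichain (· ≤ ·) (A : Set (ℕ × ℕ)) → A.card ≤ k) :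
    finWidth Q ≤ k := by
  refine csSup_le ⟨0, ∅, ⟨by simp, by simp⟩, rfl⟩ ?_
  rintro _ ⟨A, ⟨hA, hA'⟩, rfl⟩
  exact h A hA hA'

lemma card_le_finWidth {Q A : Finset (ℕ × ℕ)} (hA : A ⊆ Q)
    (hA' : IsAntichain (· ≤ ·) (A : Set (ℕ × ℕ))) : A.card ≤ finWidth Q := by
  refine le_csSup ⟨Q.card, ?_⟩ ⟨A, ⟨hA, hA'⟩, rfl⟩
  rintro _ ⟨B, ⟨hB, -⟩, rfl⟩
  exact Finset.card_le_card hB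

/-- Strict nesting of the intervals `[j, i)` attached to the pairs `(i, j)`;
antichains for the componentwise order are the chains of this relation. -/
def Nested (α β : ℕ × ℕ) : Prop := α.1 < β.1 ∧ β.2 < α.2

lemma nested_or_nested_of_incomparable {α β : ℕ × ℕ} (h : ¬ α ≤ β) (h' : ¬ β ≤ α) :
    Nested α β ∨ Nested β α := by
  simp only [Prod.le_def, Nested] at *
  omega

lemma Nested.trans {α β γ : ℕ × ℕ} (h : Nested α β) (h' : Nested β γ) : Nested α γ :=
  ⟨h.1.trans h'.1, h'.2.trans h.2⟩

lemma Nested.notMem {α : ℕ × ℕ} {S : Finset (ℕ × ℕ)} (h : ∀ β ∈ S, Nested α β) : α ∉ S :=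
  fun hα => lt_irrefl _ (h α hα).1

lemma isAntichain_insert_of_nested {α : ℕ × ℕ} {S : Finset (ℕ × ℕ)}
    (hS : IsAntichain (· ≤ ·) (S : Set (ℕ × ℕ))) (h : ∀ β ∈ S, Nested α β) :
    IsAntichain (· ≤ ·) ((insert α S : Finset (ℕ × ℕ)) : Set (ℕ × ℕ)) := by
  rw [Finset.coe_insert, isAntichain_insert]
  refine ⟨hS, fun β hβ _ => ?_⟩
  have := h β hβ
  simp only [Nested, Prod.le_def] at *
  omega

lemma Nested.mem_posetPd {n d : ℕ} {α β : ℕ × ℕ} (h : Nested α β) (hα : α ∈ posetPd n d)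
    (hβ : β ∈ posetP n) : β ∈ posetPd n d := by
  simp only [posetPd, Finset.mem_filter, Nested] at *
  exact ⟨hβ, by omega, by omega⟩

open Classical in
/-- The maximal `c`-weight of an antichain in `posetP n` consisting of pairs
strictly containing `α`. -/
noncomputable def outerWeight (n : ℕ) (c : ℕ × ℕ → ℕ) (α : ℕ × ℕ) : ℕ :=
  ((posetP n).powerset.filter fun S : Finset (ℕ × ℕ) =>
    IsAntichain (· ≤ ·) (S : Set (ℕ × ℕ)) ∧ ∀ β ∈ S, Nested α β).sup fun S => ∑ β ∈ S, c β

lemma exists_outerWeight_eq (n : ℕ) (c : ℕ × ℕ → ℕ) (α : ℕ × ℕ) :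
    ∃ S ⊆ posetP n, IsAntichain (· ≤ ·) (S : Set (ℕ × ℕ)) ∧ (∀ β ∈ S, Nested α β) ∧
      outerWeight n c α = ∑ β ∈ S, c β := by
  classical
  obtain ⟨S, hS, hS'⟩ := Finset.exists_mem_eq_sup
    ((posetP n).powerset.filter fun S : Finset (ℕ × ℕ) =>
      IsAntichain (· ≤ ·) (S : Set (ℕ × ℕ)) ∧ ∀ β ∈ S, Nested α β)
    ⟨∅, by simp⟩ (fun S => ∑ β ∈ S, c β)
  simp only [Finset.mem_filter, Finset.mem_powerset] at hS
  refine ⟨S, hS.1, hS.2.1, hS.2.2, ?_⟩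
  rw [← hS', outerWeight]

lemma sum_le_outerWeight {n : ℕ} (c : ℕ × ℕ → ℕ) {α : ℕ × ℕ} {S : Finset (ℕ × ℕ)}
    (hS : S ⊆ posetP n) (hS' : IsAntichain (· ≤ ·) (S : Set (ℕ × ℕ)))
    (h : ∀ β ∈ S, Nested α β) : ∑ β ∈ S, c β ≤ outerWeight n c α := by
  classical
  exact Finset.le_sup (f := fun S => ∑ β ∈ S, c β)
    (by simp only [Finset.mem_filter, Finset.mem_powerset]; exact ⟨hS, hS', h⟩)

lemma Nested.outerWeight_add_le {n : ℕ} (c : ℕ × ℕ → ℕ) {α β : ℕ × ℕ} (h : Nested α β)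
    (hβ : β ∈ posetP n) : outerWeight n c β + c β ≤ outerWeight n c α := by
  obtain ⟨S, hS, hanti, hnest, heq⟩ := exists_outerWeight_eq n c β
  rw [heq, add_comm, ← Finset.sum_insert (Nested.notMem hnest)]
  refine sum_le_outerWeight c (Finset.insert_subset hβ hS)
    (isAntichain_insert_of_nested hanti hnest) ?_
  intro γ hγ
  rcases Finset.mem_insert.1 hγ with rfl | hγ
  · exact h
  · exact h.trans (hnest γ hγ)

lemma outerWeight_add_le {n d h : ℕ} {c : ℕ × ℕ → ℕ}
    (hc : ∀ S ⊆ posetPd n d, IsAntichain (· ≤ ·) (S : Set (ℕ × ℕ)) → ∑ β ∈ S, c β ≤ h)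
    {α : ℕ × ℕ} (hα : α ∈ posetPd n d) : outerWeight n c α + c α ≤ h := by
  obtain ⟨S, hS, hanti, hnest, heq⟩ := exists_outerWeight_eq n c α
  rw [heq, add_comm, ← Finset.sum_insert (Nested.notMem hnest)]
  exact hc _ (Finset.insert_subset hα fun β hβ => (hnest β hβ).mem_posetPd hα (hS hβ))
    (isAntichain_insert_of_nested hanti hnest)

/-- The pairs of `posetPD n D` whose time slot `[t, t + c)` meets the residue class of `k`
modulo `K`, where `t` is the outer weight. -/
noncomputable def residueLayer (n : ℕ) (D : Finset ℕ) (c : ℕ × ℕ → ℕ) (K k : ℕ) :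
    Finset (ℕ × ℕ) :=
  (posetPD n D).filter fun α =>
    k ∈ (Finset.Ico (outerWeight n c α) (outerWeight n c α + c α)).image (· % K)

lemma finWidth_residueLayer_le {n d h : ℕ} {D : Finset ℕ} {c : ℕ × ℕ → ℕ}
    (hc : ∀ S ⊆ posetPd n d, IsAntichain (· ≤ ·) (S : Set (ℕ × ℕ)) → ∑ β ∈ S, c β ≤ h)
    (K k : ℕ) :
    finWidth (residueLayer n D c K k ∩ posetPd n d) ≤
      ((Finset.range h).filter fun s => s % K = k).card := by
  refine finWidth_le fun A hA hanti => ?_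
  have hslot : ∀ α ∈ A, ∃ s, outerWeight n c α ≤ s ∧ s < outerWeight n c α + c α ∧ s % K = k := by
    intro α hα
    have := (Finset.mem_filter.1 (Finset.mem_inter.1 (hA hα)).1).2
    simpa [and_assoc] using this
  have hmem : ∀ α ∈ A, α ∈ posetPd n d := fun α hα => (Finset.mem_inter.1 (hA hα)).2
  have hP : ∀ α ∈ A, α ∈ posetP n := fun α hα => (Finset.mem_filter.1 (hmem α hα)).1
  choose! s hs using hslot
  refine Finset.card_le_card_of_injOn s ?_ ?_
  · intro α hα
    have := outerWeight_add_le hc (hmem α hα)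
    have := hs α hα
    simp only [Finset.coe_filter, Finset.mem_range, Set.mem_ofPred_eq]
    omega
  · intro α hα β hβ hαβ
    by_contra hne
    have h1 := hs α hα
    have h2 := hs β hβ
    rcases nested_or_nested_of_incomparable (hanti hα hβ hne)
      (hanti hβ hα (Ne.symm hne)) with h | h
    · have := h.outerWeight_add_le c (hP β hβ)
      omega
    · have := h.outerWeight_add_le c (hP α hα)
      omega

lemma card_image_mod_Ico {K t c : ℕ} (h : c ≤ K) :
    ((Finset.Ico t (t + c)).image (· % K)).card = c := by
  rw [Finset.card_image_of_injOn, Nat.card_Ico, Nat.add_sub_cancel_left]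
  intro a ha b hb hab
  simp only [Finset.coe_Ico, Set.mem_Ico] at ha hb
  have hmod : a ≡ b [MOD K] := hab
  rcases le_total a b with hle | hle
  · have := Nat.eq_zero_of_dvd_of_lt ((Nat.modEq_iff_dvd' hle).1 hmod) (by omega)
    omega
  · have := Nat.eq_zero_of_dvd_of_lt ((Nat.modEq_iff_dvd' hle).1 hmod.symm) (by omega)
    omega

/-- Integral weights: the inequalities for indicator functions defining `polytopeXD` imply those
for all weights. -/
lemma sum_nat_mul_le {n : ℕ} {D : Finset ℕ} {m : ℕ → ℕ} {M : ℕ} {x : ℕ × ℕ → ℝ}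
    (hx : x ∈ polytopeXD n D m M) {c : ℕ × ℕ → ℕ} {K : ℕ} {h : ℕ → ℕ}
    (hK : ∀ α ∈ posetPD n D, c α ≤ K)
    (hc : ∀ d ∈ D, ∀ S ⊆ posetPd n d, IsAntichain (· ≤ ·) (S : Set (ℕ × ℕ)) →
      ∑ β ∈ S, c β ≤ h d) :
    ∑ α ∈ posetPD n D, (c α : ℝ) * x α ≤ M * K + ∑ d ∈ D, (m d : ℝ) * h d := by
  obtain ⟨-, -, hx⟩ := hx
  have hlayers : ∑ α ∈ posetPD n D, (c α : ℝ) * x α =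
      ∑ k ∈ Finset.range K, ∑ α ∈ residueLayer n D c K k, x α := by
    simp only [residueLayer, Finset.sum_filter]
    rw [Finset.sum_comm]
    refine Finset.sum_congr rfl fun α hα => ?_
    rw [← Finset.sum_filter, Finset.sum_const, nsmul_eq_mul]
    congr 2
    have hc' := card_image_mod_Ico (t := outerWeight n c α) (hK α hα)
    rw [← hc', Finset.filter_mem_eq_inter]
    congr 1
    rw [hc', Finset.inter_eq_right.2]
    intro k hk
    obtain ⟨s, hs, rfl⟩ := Finset.mem_image.1 hk
    have := hK α hα
    rw [Finset.mem_Ico] at hs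
    exact Finset.mem_range.2 (Nat.mod_lt _ (by omega))
  have hcount : ∀ d ∈ D, ∑ k ∈ Finset.range K,
      (finWidth (residueLayer n D c K k ∩ posetPd n d) : ℝ) ≤ h d := by
    intro d hd
    rw [← Nat.cast_sum, Nat.cast_le]
    refine (Finset.sum_le_sum fun k _ => finWidth_residueLayer_le (hc d hd) K k).trans ?_
    rw [Finset.sum_card_fiberwise_eq_card_filter]
    exact (Finset.card_filter_le _ _).trans_eq (Finset.card_range _)
  rw [hlayers]
  calc ∑ k ∈ Finset.range K, ∑ α ∈ residueLayer n D c K k, x α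
      ≤ ∑ k ∈ Finset.range K, ((M : ℝ) + ∑ d ∈ D, (m d : ℝ) *
          (finWidth (residueLayer n D c K k ∩ posetPd n d) : ℝ)) :=
        Finset.sum_le_sum fun k _ => hx _ (Finset.filter_subset _ _)
    _ = M * K + ∑ d ∈ D, (m d : ℝ) * ∑ k ∈ Finset.range K,
          (finWidth (residueLayer n D c K k ∩ posetPd n d) : ℝ) := by
        rw [Finset.sum_add_distrib, Finset.sum_comm]
        simp [Finset.mul_sum, mul_comm]
    _ ≤ M * K + ∑ d ∈ D, (m d : ℝ) * h d := by
        gcongr with d hd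
        exact hcount d hd

lemma sum_mul_le {n : ℕ} {D : Finset ℕ} {m : ℕ → ℕ} {M : ℕ} {x : ℕ × ℕ → ℝ}
    (hx : x ∈ polytopeXD n D m M) {c : ℕ × ℕ → ℝ} {K : ℝ} {h : ℕ → ℝ}
    (hc0 : ∀ α, 0 ≤ c α) (hK0 : 0 ≤ K) (hK : ∀ α ∈ posetPD n D, c α ≤ K)
    (hc : ∀ d ∈ D, ∀ S ⊆ posetPd n d, IsAntichain (· ≤ ·) (S : Set (ℕ × ℕ)) →
      ∑ β ∈ S, c β ≤ h d) :
    ∑ α ∈ posetPD n D, c α * x α ≤ M * K + ∑ d ∈ D, (m d : ℝ) * h d := by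
  have hh0 : ∀ d ∈ D, 0 ≤ h d := fun d hd => by simpa using hc d hd ∅ (by simp) (by simp)
  have key : ∀ N : ℕ, N * (∑ α ∈ posetPD n D, c α * x α) ≤
      N * (M * K + ∑ d ∈ D, (m d : ℝ) * h d) + ∑ α ∈ posetPD n D, x α := by
    intro N
    have hN : (0 : ℝ) ≤ N := Nat.cast_nonneg N
    have hfloor := sum_nat_mul_le hx (c := fun α => ⌊N * c α⌋₊) (K := ⌊N * K⌋₊)
      (h := fun d => ⌊N * h d⌋₊)
      (fun α hα => Nat.floor_mono (mul_le_mul_of_nonneg_left (hK α hα) hN))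
      (fun d hd S hS hanti => by
        refine Nat.le_floor ?_
        rw [Nat.cast_sum]
        calc ∑ β ∈ S, (⌊N * c β⌋₊ : ℝ) ≤ ∑ β ∈ S, N * c β :=
              Finset.sum_le_sum fun β _ => Nat.floor_le (mul_nonneg hN (hc0 β))
          _ = N * ∑ β ∈ S, c β := (Finset.mul_sum ..).symm
          _ ≤ N * h d := mul_le_mul_of_nonneg_left (hc d hd S hS hanti) hN)
    have hupper : (M : ℝ) * ⌊N * K⌋₊ + ∑ d ∈ D, (m d : ℝ) * ⌊N * h d⌋₊ ≤
        N * (M * K + ∑ d ∈ D, (m d : ℝ) * h d) := by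
      rw [mul_add, Finset.mul_sum]
      refine add_le_add ?_ (Finset.sum_le_sum fun d hd => ?_)
      · rw [mul_left_comm]
        exact mul_le_mul_of_nonneg_left (Nat.floor_le (mul_nonneg hN hK0)) (Nat.cast_nonneg _)
      · rw [mul_left_comm]
        exact mul_le_mul_of_nonneg_left (Nat.floor_le (mul_nonneg hN (hh0 d hd)))
          (Nat.cast_nonneg _)
    have hlower : N * (∑ α ∈ posetPD n D, c α * x α) ≤
        ∑ α ∈ posetPD n D, (⌊N * c α⌋₊ : ℝ) * x α + ∑ α ∈ posetPD n D, x α := by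
      rw [Finset.mul_sum, ← Finset.sum_add_distrib]
      refine Finset.sum_le_sum fun α _ => ?_
      have := mul_le_mul_of_nonneg_right (Nat.lt_floor_add_one (N * c α)).le (hx.2.1 α)
      linarith
    linarith
  by_contra! hlt
  obtain ⟨N, hN⟩ := exists_nat_gt ((∑ α ∈ posetPD n D, x α) /
    (∑ α ∈ posetPD n D, c α * x α - (M * K + ∑ d ∈ D, (m d : ℝ) * h d)))
  rw [div_lt_iff₀ (sub_pos.2 hlt)] at hN
  have := key N
  linarith

lemma polytopeXD_downClosed {n : ℕ} {D : Finset ℕ} {m : ℕ → ℕ} {M : ℕ} {x y : ℕ × ℕ → ℝ}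
    (hx : x ∈ polytopeXD n D m M) (hy0 : ∀ α, 0 ≤ y α) (hyx : ∀ α, y α ≤ x α) :
    y ∈ polytopeXD n D m M :=
  ⟨fun α hα => le_antisymm ((hyx α).trans (hx.1 α hα).le) (hy0 α), hy0,
    fun P' hP' => (Finset.sum_le_sum fun α _ => hyx α).trans (hx.2.2 P' hP')⟩

lemma convex_polytopeXD (n : ℕ) (D : Finset ℕ) (m : ℕ → ℕ) (M : ℕ) :
    Convex ℝ (polytopeXD n D m M) := by
  intro x hx y hy a b ha hb hab
  refine ⟨fun α hα => by simp [hx.1 α hα, hy.1 α hα], fun α => ?_, fun P' hP' => ?_⟩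
  · exact add_nonneg (mul_nonneg ha (hx.2.1 α)) (mul_nonneg hb (hy.2.1 α))
  · simp only [Pi.add_apply, Pi.smul_apply, smul_eq_mul, Finset.sum_add_distrib,
      ← Finset.mul_sum]
    refine (add_le_add (mul_le_mul_of_nonneg_left (hx.2.2 P' hP') ha)
      (mul_le_mul_of_nonneg_left (hy.2.2 P' hP') hb)).trans_eq ?_
    rw [← add_mul, hab, one_mul]

lemma isClosed_polytopeXD (n : ℕ) (D : Finset ℕ) (m : ℕ → ℕ) (M : ℕ) :
    IsClosed (polytopeXD n D m M) := by
  simp only [polytopeXD, Set.ofPred_and, Set.ofPred_forall]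
  refine IsClosed.inter ?_ (IsClosed.inter ?_ ?_)
  · exact isClosed_iInter fun α => isClosed_iInter fun _ =>
      isClosed_eq (continuous_apply α) continuous_const
  · exact isClosed_iInter fun α => isClosed_le continuous_const (continuous_apply α)
  · exact isClosed_iInter fun P' => isClosed_iInter fun _ =>
      isClosed_le (continuous_finsetSum _ fun α _ => continuous_apply α) continuous_const

lemma isCompact_polytopeXD (n : ℕ) (D : Finset ℕ) (m : ℕ → ℕ) (M : ℕ) :
    IsCompact (polytopeXD n D m M) := by
  set B : ℝ := M + ∑ d ∈ D, (m d : ℝ) * (finWidth (posetPD n D ∩ posetPd n d) : ℝ)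
  have hB0 : 0 ≤ B := by positivity
  refine (isCompact_univ_pi fun _ : ℕ × ℕ =>
    isCompact_Icc (a := (0 : ℝ)) (b := B)).of_isClosed_subset (isClosed_polytopeXD n D m M) ?_
  intro x hx α _
  refine ⟨hx.2.1 α, ?_⟩
  by_cases hα : α ∈ posetPD n D
  · exact (Finset.single_le_sum (fun β _ => hx.2.1 β) hα).trans
      (hx.2.2 _ subset_rfl)
  · rw [hx.1 α hα]
    exact hB0

/-- A combination of indicators of antichains in the `posetPd n d` and of a point lies in the
polytope. -/
lemma antichain_combination_mem_polytopeXD {n : ℕ} {D : Finset ℕ} (m : ℕ → ℕ) (M : ℕ)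
    {S : ℕ → Finset (ℕ × ℕ)} {γ : ℕ × ℕ} (hS : ∀ d ∈ D, S d ⊆ posetPd n d)
    (hanti : ∀ d ∈ D, IsAntichain (· ≤ ·) (S d : Set (ℕ × ℕ))) (hγ : γ ∈ posetPD n D) :
    (fun α => M * (if α = γ then (1 : ℝ) else 0) +
      ∑ d ∈ D, (m d : ℝ) * (if α ∈ S d then 1 else 0)) ∈ polytopeXD n D m M := by
  refine ⟨fun α hα => ?_, fun α => by positivity, fun P' hP' => ?_⟩
  · have h1 : α ≠ γ := fun h => hα (h ▸ hγ)
    have h2 : ∀ d ∈ D, α ∉ S d := fun d hd h =>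
      hα (Finset.mem_biUnion.2 ⟨d, hd, hS d hd h⟩)
    dsimp only
    rw [if_neg h1, Finset.sum_eq_zero fun d hd => by rw [if_neg (h2 d hd), mul_zero]]
    simp
  · rw [Finset.sum_add_distrib, Finset.sum_comm]
    refine add_le_add ?_ (Finset.sum_le_sum fun d hd => ?_)
    · rw [← Finset.mul_sum, Finset.sum_ite_eq']
      refine mul_le_of_le_one_right (Nat.cast_nonneg _) ?_
      split_ifs <;> norm_num
    · rw [← Finset.mul_sum, Finset.sum_boole]
      refine mul_le_mul_of_nonneg_left (Nat.cast_le.2 (card_le_finWidth ?_ ?_))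
        (Nat.cast_nonneg _)
      · intro α hα
        rw [Finset.mem_filter] at hα
        exact Finset.mem_inter.2 ⟨hα.1, hS d hd hα.2⟩
      · exact (hanti d hd).subset fun α hα => (Finset.mem_filter.1 hα).2

lemma sum_mul_antichain_combination {n : ℕ} {D : Finset ℕ} (m : ℕ → ℕ) (M : ℕ)
    {S : ℕ → Finset (ℕ × ℕ)} {γ : ℕ × ℕ} (hS : ∀ d ∈ D, S d ⊆ posetPd n d)
    (hγ : γ ∈ posetPD n D) (c : ℕ × ℕ → ℝ) :
    ∑ α ∈ posetPD n D, c α * (M * (if α = γ then (1 : ℝ) else 0) +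
      ∑ d ∈ D, (m d : ℝ) * (if α ∈ S d then 1 else 0)) =
    M * c γ + ∑ d ∈ D, (m d : ℝ) * ∑ α ∈ S d, c α := by
  simp only [mul_add, Finset.sum_add_distrib, Finset.mul_sum]
  congr 1
  · simp [hγ, mul_comm]
  · rw [Finset.sum_comm]
    refine Finset.sum_congr rfl fun d hd => ?_
    have hsub : S d ⊆ posetPD n D := fun α hα => Finset.mem_biUnion.2 ⟨d, hd, hS d hd hα⟩
    rw [← Finset.sum_subset hsub fun α _ hα => by simp [hα]]
    exact Finset.sum_congr rfl fun α hα => by simp [hα, mul_comm]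

lemma map_eq_sum_of_mem_polytopeXD {n : ℕ} {D : Finset ℕ} {m : ℕ → ℕ} {M : ℕ}
    {x : ℕ × ℕ → ℝ} (hx : x ∈ polytopeXD n D m M) (f : (ℕ × ℕ → ℝ) →ₗ[ℝ] ℝ) :
    f x = ∑ α ∈ posetPD n D, f (Pi.single α 1) * x α := by
  have : x = ∑ α ∈ posetPD n D, x α • (Pi.single α (1 : ℝ) : ℕ × ℕ → ℝ) := by
    ext β
    by_cases hβ : β ∈ posetPD n D
    · simp [Finset.sum_apply, Pi.single_apply, hβ]
    · simp [Finset.sum_apply, Pi.single_apply, hβ, hx.1 β hβ]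
  conv_lhs => rw [this]
  simp [mul_comm]

lemma add_subset_polytopeXD (n : ℕ) (D : Finset ℕ) (m m' : ℕ → ℕ) (M M' : ℕ) :
    polytopeXD n D m M + polytopeXD n D m' M' ⊆
      polytopeXD n D (fun d => m d + m' d) (M + M') := by
  rintro _ ⟨x, hx, y, hy, rfl⟩
  refine ⟨fun α hα => by simp [hx.1 α hα, hy.1 α hα],
    fun α => add_nonneg (hx.2.1 α) (hy.2.1 α), fun P' hP' => ?_⟩
  simp only [Pi.add_apply, Finset.sum_add_distrib, Nat.cast_add, add_mul]
  linarith [hx.2.2 P' hP', hy.2.2 P' hP']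

/-- The positive part of a linear functional takes at `x` a value that the functional itself takes
in the polytope. -/
lemma exists_mem_polytopeXD_map_eq {n : ℕ} {D : Finset ℕ} {m : ℕ → ℕ} {M : ℕ}
    {x : ℕ × ℕ → ℝ} (hx : x ∈ polytopeXD n D m M) (f : (ℕ × ℕ → ℝ) →ₗ[ℝ] ℝ) :
    ∃ y ∈ polytopeXD n D m M,
      f y = ∑ α ∈ posetPD n D, max (f (Pi.single α 1)) 0 * x α := by
  have hy : (fun α => if 0 ≤ f (Pi.single α 1) then x α else 0) ∈ polytopeXD n D m M := by
    refine polytopeXD_downClosed hx (fun α => ?_) fun α => ?_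
    · have := hx.2.1 α
      split_ifs <;> simp [this]
    · have := hx.2.1 α
      split_ifs <;> simp [this]
  refine ⟨_, hy, ?_⟩
  rw [map_eq_sum_of_mem_polytopeXD hy]
  refine Finset.sum_congr rfl fun α _ => ?_
  split_ifs with h
  · rw [max_eq_left h]
  · rw [max_eq_right (not_le.1 h).le]
    simp

lemma exists_max_weight_antichain (Q : Finset (ℕ × ℕ)) (c : ℕ × ℕ → ℝ) :
    ∃ S ⊆ Q, IsAntichain (· ≤ ·) (S : Set (ℕ × ℕ)) ∧
      ∀ T ⊆ Q, IsAntichain (· ≤ ·) (T : Set (ℕ × ℕ)) → ∑ β ∈ T, c β ≤ ∑ β ∈ S, c β := by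
  classical
  obtain ⟨S, hS, hmax⟩ := Finset.exists_max_image
    (Q.powerset.filter fun S : Finset (ℕ × ℕ) => IsAntichain (· ≤ ·) (S : Set (ℕ × ℕ)))
    (fun S => ∑ β ∈ S, c β) ⟨∅, by simp⟩
  simp only [Finset.mem_filter, Finset.mem_powerset] at hS hmax
  exact ⟨S, hS.1, hS.2, fun T hT hT' => hmax T ⟨hT, hT'⟩⟩

lemma posetPD_nonempty {n : ℕ} {D : Finset ℕ} (hD : D.Nonempty)
    (hDn : ∀ d ∈ D, 1 ≤ d ∧ d < n) : (posetPD n D).Nonempty := by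
  obtain ⟨d, hd⟩ := hD
  have := hDn d hd
  refine ⟨(n, 1), Finset.mem_biUnion.2 ⟨d, hd, ?_⟩⟩
  simp only [posetPd, posetP, Finset.mem_filter, Finset.mem_product, Finset.mem_range]
  omega

/-- Minkowski sum property for the polytopes in the parabolic case:
`X_{𝐝,𝐦,M} + X_{𝐝,𝐦',M'} = X_{𝐝,𝐦+𝐦',M+M'}`. -/
theorem statement9 (n : ℕ) (hn : 2 ≤ n) (D : Finset ℕ) (hD : D.Nonempty)
    (hDn : ∀ d ∈ D, 1 ≤ d ∧ d < n) (m m' : ℕ → ℕ)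
    (hm : ∀ i, i ∉ D → m i = 0) (hm' : ∀ i, i ∉ D → m' i = 0) (M M' : ℕ) :
    polytopeXD n D m M + polytopeXD n D m' M' =
      polytopeXD n D (fun d => m d + m' d) (M + M') := by
  refine (add_subset_polytopeXD n D m m' M M').antisymm fun x hx => ?_
  by_contra hxn
  obtain ⟨f, u, hfu, hux⟩ := geometric_hahn_banach_closed_point
    ((convex_polytopeXD n D m M).add (convex_polytopeXD n D m' M'))
    ((isCompact_polytopeXD n D m M).add (isCompact_polytopeXD n D m' M')).isClosed hxn
  set g : (ℕ × ℕ → ℝ) →ₗ[ℝ] ℝ := (f : (ℕ × ℕ → ℝ) →ₗ[ℝ] ℝ)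
  set c : ℕ × ℕ → ℝ := fun α => max (g (Pi.single α 1)) 0
  have hsum : ∀ a ∈ polytopeXD n D m M, ∀ b ∈ polytopeXD n D m' M',
      ∑ α ∈ posetPD n D, c α * a α + ∑ α ∈ posetPD n D, c α * b α < u := by
    intro a ha b hb
    obtain ⟨a', ha', haeq⟩ := exists_mem_polytopeXD_map_eq ha g
    obtain ⟨b', hb', hbeq⟩ := exists_mem_polytopeXD_map_eq hb g
    rw [← haeq, ← hbeq, ← map_add]
    exact hfu _ (Set.add_mem_add ha' hb')
  have hxc : u < ∑ α ∈ posetPD n D, c α * x α := by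
    refine hux.trans_le ((map_eq_sum_of_mem_polytopeXD hx g).trans_le ?_)
    exact Finset.sum_le_sum fun α _ =>
      mul_le_mul_of_nonneg_right (le_max_left _ _) (hx.2.1 α)
  obtain ⟨γ, hγ, hγmax⟩ := Finset.exists_max_image (posetPD n D) c (posetPD_nonempty hD hDn)
  choose S hS hanti hmax using fun d => exists_max_weight_antichain (posetPd n d) c
  have hlt := hsum _
    (antichain_combination_mem_polytopeXD m M (fun d _ => hS d) (fun d _ => hanti d) hγ) _
    (antichain_combination_mem_polytopeXD m' M' (fun d _ => hS d) (fun d _ => hanti d) hγ)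
  rw [sum_mul_antichain_combination m M (fun d _ => hS d) hγ,
    sum_mul_antichain_combination m' M' (fun d _ => hS d) hγ] at hlt
  have hle := sum_mul_le hx (c := c) (K := c γ) (h := fun d => ∑ α ∈ S d, c α)
    (fun α => le_max_right _ _) (le_max_right _ _) hγmax (fun d _ => hmax d)
  simp only [Nat.cast_add, add_mul, Finset.sum_add_distrib] at hle
  linarith
end

section
/- Let k be a field of characteristic zero, let W be a k-vector space regarded as an abelian Lie algebra, and let V = k ⊕ W be the W-module on which an element w ∈ W acts by w·(c, u) = (0, c·w). For M ≥ 1, consider the W-module V^{⊗M} (tensor product of Lie algebra modules) and the vector v_M = (1,0)^{⊗M}. Then: (1) for any p > M and any w_1, …, w_p ∈ W one has w_1·(w_2·(… (w_p·v_M)…)) = 0; and (2) for any p ≤ M, the induced k-linear map from the p-th symmetric power Sym^p(W) to V^{⊗M} sending the class of w_1⋯w_p to w_1·(…(w_p·v_M)…) is injective. Consequently the W-submodule of V^{⊗M} generated by v_M is isomorphic to the quotient of the symmetric algebra Sym(W) by the ideal generated by all elements of degree M+1. -/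
open scoped TensorProduct

noncomputable section

/-- The action of `w ∈ W` on `V = k ⊕ W`: `w · (c, u) = (0, c • w)`. -/
def actV (k W : Type*) [Field k] [AddCommGroup W] [Module k W] (w : W) :
    (k × W) →ₗ[k] (k × W) where
  toFun cv := (0, cv.1 • w)
  map_add' a b := by simp [add_smul]
  map_smul' r a := by simp [mul_smul]

/-- The cyclic vector `v_M = (1,0)^{⊗M} ∈ V^{⊗M}`. -/
def vecM (k W : Type*) [Field k] [AddCommGroup W] [Module k W] (M : ℕ) :
    ⨂[k] (_ : Fin M), (k × W) :=
  PiTensorProduct.tprod k (fun _ => ((1 : k), (0 : W)))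

/-- The symmetric multilinear map `(w_1, …, w_p) ↦ w_1·(w_2·(…(w_p·v_M)…))`. -/
def actMulti (k W : Type*) [Field k] [AddCommGroup W] [Module k W] (M : ℕ)
    (actM : W →ₗ[k] Module.End k (⨂[k] (_ : Fin M), (k × W))) (p : ℕ) :
    MultilinearMap k (fun _ : Fin p => W) (⨂[k] (_ : Fin M), (k × W)) :=
  (LinearMap.applyₗ (vecM k W M)).compMultilinearMap
    ((MultilinearMap.mkPiAlgebraFin k p
        (Module.End k (⨂[k] (_ : Fin M), (k × W)))).compLinearMap (fun _ => actM))

/-- The submodule of the `p`-th tensor power of `W` spanned by the differences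
`w_1 ⊗ ⋯ ⊗ w_p − w_{σ(1)} ⊗ ⋯ ⊗ w_{σ(p)}`; the `p`-th symmetric power `Sym^p(W)`
is the quotient by this submodule. -/
def symPermSub (k W : Type*) [Field k] [AddCommGroup W] [Module k W] (p : ℕ) :
    Submodule k (⨂[k] (_ : Fin p), W) :=
  Submodule.span k {t | ∃ (σ : Equiv.Perm (Fin p)) (w : Fin p → W),
    t = PiTensorProduct.tprod k w - PiTensorProduct.tprod k (w ∘ σ)}


/-- The commutativity relation on the tensor algebra of `W`; the symmetric algebra
`Sym(W)` is the quotient `RingQuot` by this relation. -/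
inductive SymRel (k W : Type*) [Field k] [AddCommGroup W] [Module k W] :
    TensorAlgebra k W → TensorAlgebra k W → Prop
  | comm (w w' : W) : SymRel k W
      (TensorAlgebra.ι k w * TensorAlgebra.ι k w')
      (TensorAlgebra.ι k w' * TensorAlgebra.ι k w)

/-- The symmetric algebra `Sym(W)`. -/
abbrev SymAlgebra (k W : Type*) [Field k] [AddCommGroup W] [Module k W] :=
  RingQuot (SymRel k W)

/-- The ideal of `Sym(W)` generated by all elements of degree `M + 1`
(equivalently, by all products of `M + 1` generators), viewed as a `k`-submodule. -/
def degSubmodule (k W : Type*) [Field k] [AddCommGroup W] [Module k W] (M : ℕ) :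
    Submodule k (SymAlgebra k W) :=
  Submodule.span k {x | ∃ (w : Fin (M + 1) → W) (a b : SymAlgebra k W),
    x = a * RingQuot.mkAlgHom k (SymRel k W)
          ((List.ofFn fun i => TensorAlgebra.ι k (w i)).prod) * b}

/-- The `W`-submodule of `V^{⊗M}` generated by `v_M`: the span of all iterated
actions of elements of `W` applied to `v_M`. -/
def orbitSpan (k W : Type*) [Field k] [AddCommGroup W] [Module k W] (M : ℕ)
    (actM : W →ₗ[k] Module.End k (⨂[k] (_ : Fin M), (k × W))) :
    Submodule k (⨂[k] (_ : Fin M), (k × W)) :=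
  Submodule.span k {v | ∃ (p : ℕ) (w : Fin p → W),
    v = ((List.ofFn fun i => actM (w i)).prod) (vecM k W M)}

section

variable {k W : Type*} [Field k] [AddCommGroup W] [Module k W]

lemma actV_mul_actV (w w' : W) : actV k W w * actV k W w' = 0 := by
  ext <;> simp [actV]

/-- Two functions on a finite type with equal value counts differ by a permutation. -/
lemma exists_perm_of_sum_single_eq {ι κ : Type*} [Fintype ι] (f g : ι → κ)
    (h : ∑ i, Finsupp.single (f i) 1 = ∑ i, Finsupp.single (g i) 1) :
    ∃ σ : Equiv.Perm ι, f = g ∘ σ := by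
  classical
  have key : ∀ c, Nonempty ({a // f a = c} ≃ {b // g b = c}) := by
    intro c
    have h' := DFunLike.congr_fun h c
    simp only [Finsupp.coe_finsetSum, Finset.sum_apply, Finsupp.single_apply,
      Finset.sum_boole, Nat.cast_id] at h'
    rw [← Fintype.card_eq, Fintype.card_subtype, Fintype.card_subtype, h']
  exact ⟨Equiv.ofFiberEquiv fun c => (key c).some,
    funext fun i => (Equiv.ofFiberEquiv_map (fun c => (key c).some) i).symm⟩

/-- The multiplication map `W^{⊗p} → Sym(W)`. -/
def symMul (k W : Type*) [Field k] [AddCommGroup W] [Module k W] (p : ℕ) :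
    (⨂[k] (_ : Fin p), W) →ₗ[k] SymmetricAlgebra k W :=
  PiTensorProduct.lift ((MultilinearMap.mkPiAlgebra k (Fin p)
    (SymmetricAlgebra k W)).compLinearMap fun _ => SymmetricAlgebra.ι k W)

lemma symMul_tprod {p : ℕ} (w : Fin p → W) :
    symMul k W p (PiTensorProduct.tprod k w) = ∏ i, SymmetricAlgebra.ι k W (w i) := by
  simp [symMul]

lemma ker_symMul_le (p : ℕ) : LinearMap.ker (symMul k W p) ≤ symPermSub k W p := by
  classical
  let b := Module.Basis.ofVectorSpace k W
  let κ := Module.Basis.ofVectorSpaceIndex k W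
  let cls : (Fin p → κ) → (⨂[k] (_ : Fin p), W) ⧸ symPermSub k W p := fun f =>
    Submodule.Quotient.mk (PiTensorProduct.tprod k fun i => b (f i))
  let cnt : (Fin p → κ) → (κ →₀ ℕ) := fun f => ∑ i, Finsupp.single (f i) 1
  have hcls : ∀ f g, cnt f = cnt g → cls f = cls g := by
    intro f g h
    obtain ⟨σ, hσ⟩ := exists_perm_of_sum_single_eq f g h
    have hmem : (PiTensorProduct.tprod k fun i => b (g i)) -
        (PiTensorProduct.tprod k fun i => b (f i)) ∈ symPermSub k W p :=
      Submodule.subset_span ⟨σ, fun i => b (g i), by rw [hσ]; rfl⟩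
    exact ((Submodule.Quotient.eq _).2 hmem).symm
  let inv : MvPolynomial κ k →ₗ[k] (⨂[k] (_ : Fin p), W) ⧸ symPermSub k W p :=
    (MvPolynomial.basisMonomials κ k).constr k
      fun m => if h : ∃ f, cnt f = m then cls h.choose else 0
  have hinv : inv ∘ₗ (SymmetricAlgebra.equivMvPolynomial b).toLinearMap ∘ₗ symMul k W p
      = (symPermSub k W p).mkQ := by
    refine (Basis.piTensorProduct fun _ : Fin p => b).ext fun f => ?_
    have hmon : ∏ i, (MvPolynomial.X (f i) : MvPolynomial κ k)
        = MvPolynomial.basisMonomials κ k (cnt f) := by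
      simp [cnt, MvPolynomial.X, MvPolynomial.monomial_sum_one]
    have hex : ∃ g, cnt g = cnt f := ⟨f, rfl⟩
    simp only [Basis.piTensorProduct_apply, LinearMap.comp_apply, symMul_tprod,
      AlgEquiv.toLinearMap_apply, map_prod, SymmetricAlgebra.equivMvPolynomial_ι_apply]
    rw [hmon, Module.Basis.constr_basis, dif_pos hex]
    exact hcls _ _ hex.choose_spec
  intro x hx
  have := LinearMap.congr_fun hinv x
  rw [LinearMap.comp_apply, LinearMap.comp_apply, LinearMap.mem_ker.1 hx] at this
  simpa using this.symm

/-- The monomial `w_1⋯w_p` in `Sym(W)`. -/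
def symMonomial (k : Type*) {W : Type*} [Field k] [AddCommGroup W] [Module k W] (l : List W) :
    SymAlgebra k W :=
  RingQuot.mkAlgHom k (SymRel k W) (l.map (TensorAlgebra.ι k)).prod

lemma symMonomial_append (l l' : List W) :
    symMonomial k (l ++ l') = symMonomial k l * symMonomial k l' := by
  simp [symMonomial]

lemma span_symMonomial : Submodule.span k (Set.range (symMonomial k (W := W))) = ⊤ := by
  have h : Submodule.span k (Set.range fun l : List W => (l.map (TensorAlgebra.ι k)).prod) = ⊤ := by
    rw [eq_top_iff, ← Algebra.top_toSubmodule, ← TensorAlgebra.adjoin_range_ι,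
      Algebra.adjoin_eq_span]
    refine Submodule.span_mono fun x hx => ?_
    obtain ⟨l, hl, rfl⟩ := Submonoid.exists_list_of_mem_closure hx
    obtain ⟨l', rfl⟩ : l ∈ Set.range (List.map (TensorAlgebra.ι k (M := W))) := by
      rw [Set.range_list_map]
      exact hl
    exact ⟨l', rfl⟩
  have hs := RingQuot.mkAlgHom_surjective k (SymRel k W)
  have := congrArg (Submodule.map (RingQuot.mkAlgHom k (SymRel k W)).toLinearMap) h
  rw [Submodule.map_span, Submodule.map_top, LinearMap.range_eq_top.2 hs, ← Set.range_comp] at this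
  exact this

lemma symAlgebra_mul_comm (x y : SymAlgebra k W) : x * y = y * x := by
  have hx : x ∈ Submodule.span k (Set.range (symMonomial k (W := W))) :=
    by rw [span_symMonomial]; exact Submodule.mem_top
  have hy : y ∈ Submodule.span k (Set.range (symMonomial k (W := W))) :=
    by rw [span_symMonomial]; exact Submodule.mem_top
  have hgen : ∀ w w' : W, Commute (RingQuot.mkAlgHom k (SymRel k W) (TensorAlgebra.ι k w))
      (RingQuot.mkAlgHom k (SymRel k W) (TensorAlgebra.ι k w')) := by
    intro w w'
    have := RingQuot.mkAlgHom_rel k (SymRel.comm (k := k) w w')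
    simpa [Commute, SemiconjBy] using this
  have hmon : ∀ l l' : List W, Commute (symMonomial k l) (symMonomial k l') := by
    intro l l'
    simp only [symMonomial, map_list_prod, List.map_map]
    refine Commute.list_prod_left _ _ fun a ha => Commute.list_prod_right _ _ fun b hb => ?_
    simp only [List.mem_map, Function.comp_apply] at ha hb
    obtain ⟨w, -, rfl⟩ := ha
    obtain ⟨w', -, rfl⟩ := hb
    exact hgen w w'
  change Commute x y
  induction hx using Submodule.span_induction with
  | zero => exact Commute.zero_left _
  | add a b _ _ ha hb => exact ha.add_left hb
  | smul c a _ ha => exact ha.smul_left c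
  | mem a ha =>
    obtain ⟨l, rfl⟩ := ha
    induction hy using Submodule.span_induction with
    | zero => exact Commute.zero_right _
    | add a b _ _ ha hb => exact ha.add_right hb
    | smul c a _ ha => exact ha.smul_right c
    | mem a ha =>
      obtain ⟨l', rfl⟩ := ha
      exact hmon l l'

/-- The comparison map to Mathlib's symmetric algebra. -/
def toSymmetricAlgebra (k W : Type*) [Field k] [AddCommGroup W] [Module k W] :
    SymAlgebra k W →ₐ[k] SymmetricAlgebra k W :=
  RingQuot.liftAlgHom k ⟨TensorAlgebra.lift k (SymmetricAlgebra.ι k W), by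
    rintro _ _ ⟨w, w'⟩
    simp [mul_comm]⟩

lemma toSymmetricAlgebra_symMonomial (l : List W) :
    toSymmetricAlgebra k W (symMonomial k l) = (l.map (SymmetricAlgebra.ι k W)).prod := by
  simp only [toSymmetricAlgebra, symMonomial, map_list_prod,
    List.map_map]
  congr 2
  ext w
  simp

lemma toSymmetricAlgebra_injective : Function.Injective (toSymmetricAlgebra k W) := by
  let _ : CommRing (SymAlgebra k W) :=
    { (inferInstance : Ring (SymAlgebra k W)) with mul_comm := symAlgebra_mul_comm }
  let back : SymmetricAlgebra k W →ₐ[k] SymAlgebra k W := SymmetricAlgebra.lift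
    ((RingQuot.mkAlgHom k (SymRel k W)).toLinearMap ∘ₗ TensorAlgebra.ι k)
  have h : back.comp (toSymmetricAlgebra k W) = AlgHom.id k _ := by
    refine RingQuot.ringQuot_ext' k _ _ (TensorAlgebra.hom_ext (LinearMap.ext fun w => ?_))
    simp [back, toSymmetricAlgebra]
  exact Function.LeftInverse.injective fun x => DFunLike.congr_fun h x

end

section

variable {k W : Type*} [Field k] [AddCommGroup W] [Module k W] {M : ℕ}

lemma map_update_id_tprod (i : Fin M) (a : Module.End k (k × W)) (v : Fin M → k × W) :
    PiTensorProduct.map (Function.update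
      (fun _ : Fin M => (LinearMap.id : (k × W) →ₗ[k] (k × W))) i a) (PiTensorProduct.tprod k v) =
    PiTensorProduct.tprod k (Function.update v i (a (v i))) := by
  rw [PiTensorProduct.map_tprod]
  congr 1
  ext1 j
  rcases eq_or_ne j i with rfl | h <;> simp [*]

/-- The span of the pure tensors with at least `j` factors in `W`. -/
def weightSubmodule (k W : Type*) [Field k] [AddCommGroup W] [Module k W] (M j : ℕ) :
    Submodule k (⨂[k] (_ : Fin M), (k × W)) :=
  Submodule.span k {t | ∃ v : Fin M → k × W, ∃ s : Finset (Fin M),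
    j ≤ s.card ∧ (∀ i ∈ s, (v i).1 = 0) ∧ t = PiTensorProduct.tprod k v}

lemma weightSubmodule_eq_bot {j : ℕ} (h : M < j) : weightSubmodule k W M j = ⊥ := by
  rw [weightSubmodule, Submodule.span_eq_bot]
  rintro _ ⟨v, s, hs, -, -⟩
  have := s.card_le_univ
  rw [Fintype.card_fin] at this
  omega

/-- The map `V → Sym(W)[X]`, `(c, u) ↦ c X + u`. -/
def polyFactor (k W : Type*) [Field k] [AddCommGroup W] [Module k W] :
    (k × W) →ₗ[k] Polynomial (SymmetricAlgebra k W) where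
  toFun v := v.1 • Polynomial.X + Polynomial.C (SymmetricAlgebra.ι k W v.2)
  map_add' a b := by simp only [Prod.fst_add, Prod.snd_add, map_add, add_smul]; abel
  map_smul' r a := by simp [mul_smul, Polynomial.smul_C]

/-- The multiplicative extension of `polyFactor` to `V^{⊗M}`. -/
def polyMap (k W : Type*) [Field k] [AddCommGroup W] [Module k W] (M : ℕ) :
    (⨂[k] (_ : Fin M), (k × W)) →ₗ[k] Polynomial (SymmetricAlgebra k W) :=
  PiTensorProduct.lift ((MultilinearMap.mkPiAlgebra k (Fin M)
    (Polynomial (SymmetricAlgebra k W))).compLinearMap fun _ => polyFactor k W)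

lemma polyMap_tprod (v : Fin M → k × W) :
    polyMap k W M (PiTensorProduct.tprod k v) = ∏ i, polyFactor k W (v i) := by
  simp [polyMap]

lemma polyMap_vecM : polyMap k W M (vecM k W M) = Polynomial.X ^ M := by
  simp [vecM, polyMap_tprod, polyFactor]

lemma polyFactor_actV (w : W) (v : k × W) :
    polyFactor k W (actV k W w v) =
      Polynomial.C (SymmetricAlgebra.ι k W w) * (polyFactor k W v).derivative := by
  simp [polyFactor, actV, ← Polynomial.smul_C]

/-- `actM` is the Lie-algebra tensor product action of `W` on `V^{⊗M}`. -/
def IsTensorAction (actM : W →ₗ[k] Module.End k (⨂[k] (_ : Fin M), (k × W))) : Prop :=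
  ∀ w : W, actM w = ∑ i : Fin M,
    PiTensorProduct.map (Function.update
      (fun _ : Fin M => (LinearMap.id : (k × W) →ₗ[k] (k × W))) i (actV k W w))

variable {actM : W →ₗ[k] Module.End k (⨂[k] (_ : Fin M), (k × W))}

lemma actM_tprod (hactM : IsTensorAction actM) (w : W) (v : Fin M → k × W) :
    actM w (PiTensorProduct.tprod k v) =
      ∑ i, PiTensorProduct.tprod k (Function.update v i (actV k W w (v i))) := by
  rw [hactM, LinearMap.sum_apply]
  exact Finset.sum_congr rfl fun i _ => map_update_id_tprod i _ v

lemma actM_commute (hactM : IsTensorAction actM) (w w' : W) : Commute (actM w) (actM w') := by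
  rw [hactM, hactM]
  refine Commute.sum_left _ _ _ fun i _ => Commute.sum_right _ _ _ fun j _ => ?_
  rw [commute_iff_eq, ← PiTensorProduct.map_mul, ← PiTensorProduct.map_mul]
  congr 1
  ext1 l
  by_cases hi : l = i <;> by_cases hj : l = j
  · subst hi; subst hj; simp [actV_mul_actV]
  · subst hi; simp [hj]; rfl
  · subst hj; simp [hi]; rfl
  · simp [hi, hj]

lemma actM_mem_weightSubmodule (hactM : IsTensorAction actM) (w : W) {j : ℕ}
    {x : ⨂[k] (_ : Fin M), (k × W)}
    (hx : x ∈ weightSubmodule k W M j) : actM w x ∈ weightSubmodule k W M (j + 1) := by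
  induction hx using Submodule.span_induction with
  | zero => simp
  | add a b _ _ ha hb => rw [map_add]; exact add_mem ha hb
  | smul c a _ ha => rw [map_smul]; exact Submodule.smul_mem _ _ ha
  | mem a ha =>
    obtain ⟨v, s, hs, hv, rfl⟩ := ha
    rw [actM_tprod hactM]
    refine Submodule.sum_mem _ fun i _ => ?_
    by_cases hi : i ∈ s
    · have : actV k W w (v i) = 0 := by simp [actV, hv i hi]
      rw [this, MultilinearMap.map_update_zero]
      exact zero_mem _
    · refine Submodule.subset_span ⟨_, insert i s, ?_, fun l hl => ?_, rfl⟩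
      · rw [Finset.card_insert_of_notMem hi]; omega
      · rcases eq_or_ne l i with rfl | h
        · simp [actV]
        · rw [Function.update_of_ne h]
          exact hv l ((Finset.mem_insert.1 hl).resolve_left h)

lemma prod_actM_vecM_mem (hactM : IsTensorAction actM) (l : List W) :
    (l.map actM).prod (vecM k W M) ∈ weightSubmodule k W M l.length := by
  induction l with
  | nil => exact Submodule.subset_span ⟨_, ∅, by simp, by simp, rfl⟩
  | cons w l ih =>
    rw [List.map_cons, List.prod_cons, Module.End.mul_apply, List.length_cons]
    exact actM_mem_weightSubmodule hactM w ih

lemma prod_actM_vecM_eq_zero (hactM : IsTensorAction actM) {l : List W} (h : M < l.length) :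
    (l.map actM).prod (vecM k W M) = 0 := by
  have := prod_actM_vecM_mem hactM l
  rwa [weightSubmodule_eq_bot h, Submodule.mem_bot] at this

lemma polyMap_actM (hactM : IsTensorAction actM) (w : W) (x : ⨂[k] (_ : Fin M), (k × W)) :
    polyMap k W M (actM w x) =
      Polynomial.C (SymmetricAlgebra.ι k W w) * (polyMap k W M x).derivative := by
  induction x using PiTensorProduct.induction_on with
  | add a b ha hb => simp only [map_add, ha, hb, mul_add]
  | smul_tprod r v =>
    simp only [map_smul, Polynomial.derivative_smul, mul_smul_comm]
    congr 1
    rw [actM_tprod hactM, map_sum, polyMap_tprod, Polynomial.derivative_prod_finset,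
      Finset.mul_sum]
    refine Finset.sum_congr rfl fun i _ => ?_
    rw [polyMap_tprod, ← Finset.mul_prod_erase _ _ (Finset.mem_univ i), Function.update_self,
      polyFactor_actV, Finset.prod_congr rfl fun j hj => by
        rw [Function.update_of_ne (Finset.ne_of_mem_erase hj)]]
    ring

lemma polyMap_prod_actM (hactM : IsTensorAction actM) (l : List W) :
    polyMap k W M ((l.map actM).prod (vecM k W M)) =
      Polynomial.C (l.map (SymmetricAlgebra.ι k W)).prod *
        Polynomial.derivative^[l.length] (Polynomial.X ^ M) := by
  induction l with
  | nil => simp [polyMap_vecM]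
  | cons w l ih =>
    rw [List.map_cons, List.prod_cons, Module.End.mul_apply, polyMap_actM hactM, ih,
      Polynomial.derivative_C_mul, List.length_cons, Function.iterate_succ_apply', List.map_cons,
      List.prod_cons, map_mul, mul_assoc]

end

section

variable {k W : Type*} [Field k] [AddCommGroup W] [Module k W] {M : ℕ}

/-- The degree `p` part of `Sym(W)`. -/
def homSubmodule (k W : Type*) [Field k] [AddCommGroup W] [Module k W] (p : ℕ) :
    Submodule k (SymAlgebra k W) :=
  Submodule.span k {x | ∃ l : List W, l.length = p ∧ x = symMonomial k l}

lemma symMonomial_mem_degSubmodule {l : List W} (h : M < l.length) :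
    symMonomial k l ∈ degSubmodule k W M := by
  refine Submodule.subset_span
    ⟨fun i => l.get (i.castLE h), 1, symMonomial k (l.drop (M + 1)), ?_⟩
  have htake : (List.ofFn fun i : Fin (M + 1) => l.get (i.castLE h)) = l.take (M + 1) := by
    refine List.ext_getElem (by simp; omega) fun i h₁ h₂ => ?_
    rw [List.getElem_ofFn, List.getElem_take]
    rfl
  have hmap : (List.ofFn fun i : Fin (M + 1) => TensorAlgebra.ι k (l.get (i.castLE h)))
      = (l.take (M + 1)).map (TensorAlgebra.ι k) := by
    rw [← htake, List.map_ofFn]; rfl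
  rw [hmap, one_mul]
  change _ = symMonomial k (l.take (M + 1)) * _
  rw [← symMonomial_append, List.take_append_drop]

lemma exists_homogeneous_decomposition (M : ℕ) (y : SymAlgebra k W) :
    ∃ c : ℕ → SymAlgebra k W, (∀ p, c p ∈ homSubmodule k W p) ∧
      y - ∑ p ∈ Finset.range (M + 1), c p ∈ degSubmodule k W M := by
  have hy : y ∈ Submodule.span k (Set.range (symMonomial k (W := W))) := by
    rw [span_symMonomial]; exact Submodule.mem_top
  induction hy using Submodule.span_induction with
  | zero => exact ⟨0, fun _ => zero_mem _, by simp⟩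
  | add a b _ _ ha hb =>
    obtain ⟨c, hc, hc'⟩ := ha
    obtain ⟨d, hd, hd'⟩ := hb
    refine ⟨c + d, fun p => add_mem (hc p) (hd p), ?_⟩
    convert! add_mem hc' hd' using 1
    simp only [Pi.add_apply, Finset.sum_add_distrib]
    abel
  | smul r a _ ha =>
    obtain ⟨c, hc, hc'⟩ := ha
    refine ⟨r • c, fun p => Submodule.smul_mem _ _ (hc p), ?_⟩
    convert! Submodule.smul_mem _ r hc' using 1
    simp only [Pi.smul_apply, smul_sub, Finset.smul_sum]
  | mem a ha =>
    obtain ⟨l, rfl⟩ := ha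
    by_cases h : M < l.length
    · exact ⟨0, fun _ => zero_mem _, by simpa using symMonomial_mem_degSubmodule h⟩
    · refine ⟨Pi.single l.length (symMonomial k l), fun p => ?_, ?_⟩
      · rcases eq_or_ne p l.length with rfl | hp
        · rw [Pi.single_eq_same]
          exact Submodule.subset_span ⟨l, rfl, rfl⟩
        · rw [Pi.single_eq_of_ne hp]
          exact zero_mem _
      · rw [Finset.sum_eq_single_of_mem l.length (Finset.mem_range.2 (by omega))
          fun q _ hq => Pi.single_eq_of_ne hq _, Pi.single_eq_same, sub_self]
        exact zero_mem _

variable {actM : W →ₗ[k] Module.End k (⨂[k] (_ : Fin M), (k × W))}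

/-- The action of `Sym(W)` induced by a commuting action of `W`. -/
def symAct (hcomm : ∀ w w', Commute (actM w) (actM w')) :
    SymAlgebra k W →ₐ[k] Module.End k (⨂[k] (_ : Fin M), (k × W)) :=
  RingQuot.liftAlgHom k ⟨TensorAlgebra.lift k actM, by
    rintro _ _ ⟨w, w'⟩
    simpa using (hcomm w w').eq⟩

lemma symAct_ι (hcomm : ∀ w w', Commute (actM w) (actM w')) (w : W) :
    symAct hcomm (RingQuot.mkAlgHom k (SymRel k W) (TensorAlgebra.ι k w)) = actM w := by
  simp [symAct]

lemma symAct_symMonomial (hcomm : ∀ w w', Commute (actM w) (actM w')) (l : List W) :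
    symAct hcomm (symMonomial k l) = (l.map actM).prod := by
  simp only [symMonomial, map_list_prod, List.map_map]
  congr 2
  ext1 w
  exact symAct_ι hcomm w

/-- The orbit map `y ↦ y · v_M`. -/
def orbitMap (hcomm : ∀ w w', Commute (actM w) (actM w')) :
    SymAlgebra k W →ₗ[k] ⨂[k] (_ : Fin M), (k × W) :=
  LinearMap.applyₗ (vecM k W M) ∘ₗ (symAct hcomm).toLinearMap

lemma orbitMap_apply (hcomm : ∀ w w', Commute (actM w) (actM w')) (y : SymAlgebra k W) :
    orbitMap hcomm y = symAct hcomm y (vecM k W M) := rfl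

lemma orbitMap_symMonomial (hcomm : ∀ w w', Commute (actM w) (actM w')) (l : List W) :
    orbitMap hcomm (symMonomial k l) = (l.map actM).prod (vecM k W M) := by
  rw [orbitMap_apply, symAct_symMonomial]

lemma range_orbitMap (hcomm : ∀ w w', Commute (actM w) (actM w')) :
    LinearMap.range (orbitMap hcomm) = orbitSpan k W M actM := by
  rw [← Submodule.map_top, ← span_symMonomial, Submodule.map_span, orbitSpan]
  congr 1
  ext v
  constructor
  · rintro ⟨_, ⟨l, rfl⟩, rfl⟩
    refine ⟨l.length, l.get, ?_⟩
    rw [orbitMap_symMonomial, ← List.ofFn_get l, List.map_ofFn]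
    simp [Function.comp_def]
  · rintro ⟨p, w, rfl⟩
    refine ⟨_, ⟨List.ofFn w, rfl⟩, ?_⟩
    rw [orbitMap_symMonomial, List.map_ofFn]
    rfl

lemma degSubmodule_le_ker_orbitMap (hactM : IsTensorAction actM)
    (hcomm : ∀ w w', Commute (actM w) (actM w')) :
    degSubmodule k W M ≤ LinearMap.ker (orbitMap hcomm) := by
  rw [degSubmodule, Submodule.span_le]
  rintro _ ⟨w, a, b, rfl⟩
  have hm : RingQuot.mkAlgHom k (SymRel k W) (List.ofFn fun i => TensorAlgebra.ι k (w i)).prod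
      = symMonomial k (List.ofFn w) := by
    rw [symMonomial, List.map_ofFn]; rfl
  rw [SetLike.mem_coe, LinearMap.mem_ker, hm, symAlgebra_mul_comm, ← mul_assoc, orbitMap_apply,
    map_mul, Module.End.mul_apply, ← orbitMap_apply, orbitMap_symMonomial,
    prod_actM_vecM_eq_zero hactM (by simp), map_zero]

lemma polyMap_orbitMap (hactM : IsTensorAction actM)
    (hcomm : ∀ w w', Commute (actM w) (actM w')) {p : ℕ} {x : SymAlgebra k W}
    (hx : x ∈ homSubmodule k W p) :
    polyMap k W M (orbitMap hcomm x) =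
      Polynomial.C (toSymmetricAlgebra k W x) * Polynomial.derivative^[p] (Polynomial.X ^ M) := by
  induction hx using Submodule.span_induction with
  | zero => simp
  | add a b _ _ ha hb => simp only [map_add, ha, hb, add_mul]
  | smul c a _ ha => simp only [map_smul, ha, ← Polynomial.smul_C, smul_mul_assoc]
  | mem a ha =>
    obtain ⟨l, rfl, rfl⟩ := ha
    rw [orbitMap_symMonomial, polyMap_prod_actM hactM, toSymmetricAlgebra_symMonomial]

lemma eq_zero_of_C_mul_iterate_derivative [CharZero k] {p : ℕ} (hp : p ≤ M)
    {a : SymmetricAlgebra k W}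
    (h : (Polynomial.C a * Polynomial.derivative^[p] (Polynomial.X ^ M)).coeff (M - p) = 0) :
    a = 0 := by
  rw [Polynomial.iterate_derivative_X_pow_eq_C_mul, ← mul_assoc, ← map_mul,
    Polynomial.coeff_C_mul_X_pow, if_pos rfl, mul_comm, ← nsmul_eq_mul,
    ← Nat.cast_smul_eq_nsmul k] at h
  refine (smul_eq_zero.1 h).resolve_left (Nat.cast_ne_zero.2 ?_)
  rw [Ne, Nat.descFactorial_eq_zero_iff_lt]
  omega

lemma ker_orbitMap [CharZero k] (hactM : IsTensorAction actM)
    (hcomm : ∀ w w', Commute (actM w) (actM w')) :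
    LinearMap.ker (orbitMap hcomm) = degSubmodule k W M := by
  refine le_antisymm (fun y hy => ?_) (degSubmodule_le_ker_orbitMap hactM hcomm)
  obtain ⟨c, hc, hyc⟩ := exists_homogeneous_decomposition M y
  have hsum : orbitMap hcomm (∑ p ∈ Finset.range (M + 1), c p) = 0 := by
    have := degSubmodule_le_ker_orbitMap hactM hcomm hyc
    rwa [LinearMap.mem_ker, map_sub, LinearMap.mem_ker.1 hy, zero_sub, neg_eq_zero] at this
  have hzero : ∀ p ∈ Finset.range (M + 1), c p = 0 := by
    intro p hp
    have hpM : p ≤ M := by simpa [Nat.lt_succ_iff] using hp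
    have h := congrArg (fun f => (polyMap k W M f).coeff (M - p)) hsum
    simp only [map_sum, polyMap_orbitMap hactM hcomm (hc _), map_zero, Polynomial.coeff_zero,
      Polynomial.finsetSum_coeff] at h
    rw [Finset.sum_eq_single_of_mem p hp] at h
    · exact toSymmetricAlgebra_injective
        ((eq_zero_of_C_mul_iterate_derivative hpM h).trans (map_zero _).symm)
    · intro q hq hqp
      have hqM : q ≤ M := by simpa [Nat.lt_succ_iff] using hq
      rw [Polynomial.iterate_derivative_X_pow_eq_C_mul, ← mul_assoc, ← map_mul,
        Polynomial.coeff_C_mul_X_pow, if_neg (by omega)]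
  rwa [Finset.sum_eq_zero hzero, sub_zero] at hyc

lemma actMulti_apply {p : ℕ} (w : Fin p → W) :
    actMulti k W M actM p w = ((List.ofFn w).map actM).prod (vecM k W M) := by
  simp [actMulti, List.map_ofFn, Function.comp_def]

lemma ker_lift_actMulti [CharZero k] (hactM : IsTensorAction actM)
    {p : ℕ} (hp : p ≤ M) :
    LinearMap.ker (PiTensorProduct.lift (actMulti k W M actM p)) = symPermSub k W p := by
  apply le_antisymm
  · intro x hx
    have hpoly : ∀ x, polyMap k W M (PiTensorProduct.lift (actMulti k W M actM p) x) =
        Polynomial.C (symMul k W p x) * Polynomial.derivative^[p] (Polynomial.X ^ M) := by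
      intro x
      induction x using PiTensorProduct.induction_on with
      | add a b ha hb => simp only [map_add, ha, hb, add_mul]
      | smul_tprod r v =>
        rw [map_smul, map_smul, map_smul, ← Polynomial.smul_C, smul_mul_assoc,
          PiTensorProduct.lift.tprod, actMulti_apply, polyMap_prod_actM hactM, symMul_tprod,
          List.length_ofFn, List.map_ofFn, List.prod_ofFn]
        rfl
    refine ker_symMul_le p (LinearMap.mem_ker.2 (eq_zero_of_C_mul_iterate_derivative hp ?_))
    rw [← hpoly, LinearMap.mem_ker.1 hx, map_zero, Polynomial.coeff_zero]
  · rw [symPermSub, Submodule.span_le]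
    rintro _ ⟨σ, w, rfl⟩
    rw [SetLike.mem_coe, LinearMap.mem_ker, map_sub, PiTensorProduct.lift.tprod,
      PiTensorProduct.lift.tprod, actMulti_apply, actMulti_apply, sub_eq_zero]
    congr 1
    refine ((σ.ofFn_comp_perm w).symm.map actM).prod_eq' ?_
    refine List.Pairwise.map _ (fun _ _ h => h) (List.pairwise_of_forall fun a b => ?_)
    exact actM_commute hactM a b

end

/-- Let `k` be a field of characteristic zero, `W` a `k`-vector space regarded as an
abelian Lie algebra, `V = k ⊕ W` with `w·(c,u) = (0, c·w)`, and `M ≥ 1`.  Let `actM` be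
the induced action of `W` on `V^{⊗M}` (`w` acts as `Σ_i 1 ⊗ ⋯ ⊗ (w·) ⊗ ⋯ ⊗ 1`) and
`v_M = (1,0)^{⊗M}`.  Then:
(1) any `p > M` iterated actions kill `v_M`;
(2) for `p ≤ M` the induced map from `Sym^p(W)` (the quotient of `W^{⊗p}` by the
permutation relations) to `V^{⊗M}`, `w_1⋯w_p ↦ w_1·(…(w_p·v_M)…)`, is injective, i.e.
the kernel of the lift of the multilinear map to `W^{⊗p}` is exactly `symPermSub`;
(3) consequently, the `W`-submodule of `V^{⊗M}` generated by `v_M` is isomorphic to the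
quotient of `Sym(W)` by the ideal generated by all elements of degree `M + 1`,
compatibly with the `W`-actions. -/
theorem statement10 (k W : Type*) [Field k] [CharZero k]
    [AddCommGroup W] [Module k W] (M : ℕ) (hM : 1 ≤ M)
    (actM : W →ₗ[k] Module.End k (⨂[k] (_ : Fin M), (k × W)))
    (hactM : ∀ w : W, actM w = ∑ i : Fin M,
      PiTensorProduct.map (Function.update
        (fun _ : Fin M => (LinearMap.id : (k × W) →ₗ[k] (k × W))) i (actV k W w))) :
    (∀ (p : ℕ), M < p → ∀ w : Fin p → W,
      ((List.ofFn fun i => actM (w i)).prod) (vecM k W M) = 0) ∧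
    (∀ p : ℕ, p ≤ M →
      LinearMap.ker (PiTensorProduct.lift (actMulti k W M actM p)) = symPermSub k W p) ∧
    (∃ e : (SymAlgebra k W ⧸ degSubmodule k W M) ≃ₗ[k] orbitSpan k W M actM,
      ∀ (w : W) (y : SymAlgebra k W),
        (e (Submodule.Quotient.mk
              (RingQuot.mkAlgHom k (SymRel k W) (TensorAlgebra.ι k w) * y))
            : ⨂[k] (_ : Fin M), (k × W))
          = actM w (e (Submodule.Quotient.mk y))) := by
  have hcomm := actM_commute hactM
  refine ⟨fun p hp w => ?_, fun p hp => ker_lift_actMulti hactM hp, ?_⟩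
  · have := prod_actM_vecM_eq_zero hactM (l := List.ofFn w) (by simpa using hp)
    rwa [List.map_ofFn] at this
  · refine ⟨(Submodule.quotEquivOfEq _ _ (ker_orbitMap hactM hcomm).symm).trans
      ((orbitMap hcomm).quotKerEquivRange.trans
        (LinearEquiv.ofEq _ _ (range_orbitMap hcomm))), fun w y => ?_⟩
    change orbitMap hcomm (RingQuot.mkAlgHom k (SymRel k W) (TensorAlgebra.ι k w) * y) =
      actM w (orbitMap hcomm y)
    rw [orbitMap_apply, map_mul, symAct_ι, Module.End.mul_apply, ← orbitMap_apply]
end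
end

section
/- Let 𝔞 be an abelian Lie algebra over a field k, let A and B be 𝔞-modules, and let ℓ ∈ A, u ∈ B. Fix M ∈ ℕ, elements x_1, …, x_r ∈ 𝔞 and natural numbers c_1, …, c_r such that x_i^{c_i+1}·ℓ = 0 in A for every i, and such that for every p > M and every y_1, …, y_p ∈ 𝔞 one has y_1·(…(y_p·u)…) = 0 in B. Then for any a_1, …, a_r ∈ ℕ with a_1 + … + a_r > M + (c_1 + … + c_r), one has x_1^{a_1}⋯x_r^{a_r}·(ℓ ⊗ u) = 0 in the tensor product 𝔞-module A ⊗ B. -/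
open scoped TensorProduct

section AbelianLieAction

variable {L V : Type*} [LieRing L] [AddCommGroup V] [LieRingModule L V]

theorem List.foldr_lie_zero (l : List L) : l.foldr (fun z (v : V) => ⁅z, v⁆) 0 = 0 := by
  induction l with
  | nil => rfl
  | cons z l ih => rw [List.foldr_cons, ih, lie_zero]

theorem List.foldr_replicate_eq_iterate {α β : Type*} (f : α → β → β) (n : ℕ) (z : α) (v : β) :
    (List.replicate n z).foldr f v = (f z)^[n] v := by
  induction n with
  | zero => rfl
  | succ n ih => rw [List.replicate_succ, List.foldr_cons, ih, Function.iterate_succ_apply']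

theorem List.Perm.foldr_lie_eq [IsLieAbelian L] {l₁ l₂ : List L} (h : l₁.Perm l₂) (v : V) :
    l₁.foldr (fun z (v : V) => ⁅z, v⁆) v = l₂.foldr (fun z (v : V) => ⁅z, v⁆) v := by
  have : LeftCommutative (fun (z : L) (v : V) => ⁅z, v⁆) :=
    ⟨fun y z v => by rw [leibniz_lie, trivial_lie_zero L L y z, zero_lie, zero_add]⟩
  exact h.foldr_eq v

/-- For an abelian Lie algebra, a product of more than `∑ i, c i` elements of a finite family `x`
kills any vector killed by every `x i ^ (c i + 1)`. -/
theorem List.foldr_lie_map_eq_zero_of_sum_lt_length [IsLieAbelian L] {ι : Type*} [Fintype ι]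
    [DecidableEq ι] (x : ι → L) (c : ι → ℕ) {v : V}
    (hv : ∀ i, (fun w => ⁅x i, w⁆)^[c i + 1] v = 0) {l : List ι} (hl : ∑ i, c i < l.length) :
    (l.map x).foldr (fun z (w : V) => ⁅z, w⁆) v = 0 := by
  obtain ⟨i, hi⟩ : ∃ i, c i < l.count i := by
    by_contra! h
    have hsum : ∑ i, l.count i = l.length := by
      simpa using Multiset.sum_count_eq_card (s := Finset.univ) (m := (l : Multiset ι))
        fun i _ => Finset.mem_univ i
    have := Finset.sum_le_sum fun i (_ : i ∈ Finset.univ) => h i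
    omega
  obtain ⟨m, hm⟩ := (List.replicate_sublist_iff.mpr (Nat.succ_le_of_lt hi)).exists_perm_append
  have hperm := (hm.trans List.perm_append_comm).map x
  rw [hperm.foldr_lie_eq, List.map_append, List.foldr_append, List.map_replicate,
    List.foldr_replicate_eq_iterate, Nat.succ_eq_add_one, hv, List.foldr_lie_zero]

end AbelianLieAction

/-- Leibniz expansion of an iterated action on a pure tensor. -/
theorem List.foldr_lie_tmul_mem_span (k : Type*) [CommRing k]
    {L A B : Type*} [LieRing L] [LieAlgebra k L]
    [AddCommGroup A] [Module k A] [LieRingModule L A] [LieModule k L A]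
    [AddCommGroup B] [Module k B] [LieRingModule L B] [LieModule k L B]
    {ι : Type*} (x : ι → L) (a : A) (b : B) (l : List ι) :
    (l.map x).foldr (fun z (v : A ⊗[k] B) => ⁅z, v⁆) (a ⊗ₜ[k] b) ∈
      Submodule.span k {t : A ⊗[k] B | ∃ l₁ l₂ : List ι, l₁.length + l₂.length = l.length ∧
        t = (l₁.map x).foldr (fun z v => ⁅z, v⁆) a ⊗ₜ[k]
          (l₂.map x).foldr (fun z v => ⁅z, v⁆) b} := by
  induction l with
  | nil => exact Submodule.subset_span ⟨[], [], rfl, rfl⟩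
  | cons i l ih =>
    rw [List.map_cons, List.foldr_cons]
    generalize (l.map x).foldr (fun z (v : A ⊗[k] B) => ⁅z, v⁆) (a ⊗ₜ[k] b) = w at ih
    induction ih using Submodule.span_induction with
    | zero => rw [lie_zero]; exact Submodule.zero_mem _
    | add s t _ _ hs ht => rw [lie_add]; exact Submodule.add_mem _ hs ht
    | smul q t _ ht => rw [lie_smul]; exact Submodule.smul_mem _ q ht
    | mem t ht =>
      obtain ⟨l₁, l₂, h, rfl⟩ := ht
      rw [TensorProduct.LieModule.lie_tmul_right]
      refine Submodule.add_mem _ (Submodule.subset_span ⟨i :: l₁, l₂, ?_, rfl⟩)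
        (Submodule.subset_span ⟨l₁, i :: l₂, ?_, rfl⟩) <;>
      · simp only [List.length_cons]
        omega

/-- Let `𝔞` be an abelian Lie algebra over a field `k`, `A`, `B` two `𝔞`-modules,
`ℓ ∈ A`, `u ∈ B`.  Suppose `x_i^{c_i+1}·ℓ = 0` for `i = 1,…,r` and any `p > M` iterated
actions kill `u`.  Then `x_1^{a_1}⋯x_r^{a_r}·(ℓ ⊗ u) = 0` in `A ⊗ B` whenever
`a_1 + … + a_r > M + (c_1 + … + c_r)`. -/
theorem statement11 (k : Type*) [Field k]
    (𝔞 : Type*) [LieRing 𝔞] [LieAlgebra k 𝔞] [IsLieAbelian 𝔞]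
    (A : Type*) [AddCommGroup A] [Module k A] [LieRingModule 𝔞 A] [LieModule k 𝔞 A]
    (B : Type*) [AddCommGroup B] [Module k B] [LieRingModule 𝔞 B] [LieModule k 𝔞 B]
    (ℓ : A) (u : B) (M : ℕ) (r : ℕ) (x : Fin r → 𝔞) (c : Fin r → ℕ)
    (hℓ : ∀ i, (fun v => ⁅x i, v⁆)^[c i + 1] ℓ = 0)
    (hu : ∀ (p : ℕ), M < p → ∀ y : Fin p → 𝔞,
      (List.ofFn y).foldr (fun z v => ⁅z, v⁆) u = 0)
    (a : Fin r → ℕ) (ha : M + ∑ i, c i < ∑ i, a i) :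
    (List.ofFn (fun i => List.replicate (a i) (x i))).flatten.foldr
      (fun z (v : A ⊗[k] B) => ⁅z, v⁆) (ℓ ⊗ₜ[k] u) = 0 := by
  have hlist : (List.ofFn fun i => List.replicate (a i) (x i)).flatten =
      (List.ofFn fun i => List.replicate (a i) i).flatten.map x := by
    simp [List.map_flatten, List.map_ofFn, Function.comp_def]
  have hlen : (List.ofFn fun i => List.replicate (a i) i).flatten.length = ∑ i, a i := by
    simp [List.length_flatten, List.map_ofFn, Function.comp_def, List.sum_ofFn]
  rw [hlist, ← Submodule.mem_bot k]
  refine Submodule.span_le.mpr ?_ (List.foldr_lie_tmul_mem_span k x ℓ u _)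
  rintro _ ⟨l₁, l₂, h, rfl⟩
  rw [hlen] at h
  rw [SetLike.mem_coe, Submodule.mem_bot]
  rcases lt_or_ge M l₂.length with h₂ | h₂
  · have hz := hu (l₂.map x).length (by simpa using h₂) (l₂.map x).get
    rw [List.ofFn_get] at hz
    rw [hz, TensorProduct.tmul_zero]
  · rw [List.foldr_lie_map_eq_zero_of_sum_lt_length x c hℓ (by omega), TensorProduct.zero_tmul]
end
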